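/- Let S be a finite set, let K : S × S → ℝ be a row-stochastic kernel (K(j,k) ≥ 0 and ∑_{k∈S} K(j,k) = 1 for every j), and let ν : S → ℝ be a stationary distribution of K (ν(s) ≥ 0, ∑_s ν(s) = 1, and ∑_{j} ν(j) K(j,k) = ν(k) for every k). Let n ∈ ℕ. For ℓ : S → ℕ with ∑_s ℓ(s) = n, define the multinomial PMF M(ℓ) = (n! / ∏_{s} ℓ(s)!) · ∏_{s} ν(s)^{ℓ(s)}, and for ℓ', ℓ with ∑_s ℓ'(s) = ∑_s ℓ(s) = n define Q(ℓ', ℓ) = ∑_{u} ∏_{j∈S} ( ℓ'(j)! / ∏_{k∈S} u(j,k)! ) · ∏_{j,k∈S} K(j,k)^{u(j,k)}, where the sum ranges over all u : S × S → ℕ with ∑_{k} u(j,k) = ℓ'(j) for every j and ∑_{j} u(j,k) = ℓ(k) for every k. Then M is a stationary distribution of Q: for every ℓ with ∑_s ℓ(s) = n, ∑_{ℓ' : ∑_s ℓ'(s) = n} M(ℓ') Q(ℓ', ℓ) = M(ℓ). -/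

import Mathlib

/-- Transition probability (equation (9) of the paper) of the profile of `n` independent
devices: `Q(ℓ', ℓ)` is the probability that the profile `ℓ'` (counting devices in each
per-device state) becomes `ℓ` when each device moves independently according to the
kernel `K`; the sum runs over all matrices `u` of move counts with row sums `ℓ'` and
column sums `ℓ`. -/
noncomputable def profileKernel {S : Type*} [Fintype S] [DecidableEq S]
    (K : S → S → ℝ) (l' l : S → ℕ) : ℝ :=
  ∑' u : S → S → ℕ,
    if (∀ j, ∑ k, u j k = l' j) ∧ (∀ k, ∑ j, u j k = l k) then
      (∏ j, ((l' j).factorial : ℝ) / ∏ k, ((u j k).factorial : ℝ)) *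
        ∏ j, ∏ k, K j k ^ u j k
    else 0

/-- Multinomial PMF `Mul(n, |S|, ν)`: the probability of observing the profile `ℓ` when
`n` devices are placed independently in states according to the distribution `ν`. -/
noncomputable def multinomialPMF {S : Type*} [Fintype S] (ν : S → ℝ) (n : ℕ)
    (l : S → ℕ) : ℝ :=
  ((n.factorial : ℝ) / ∏ s, ((l s).factorial : ℝ)) * ∏ s, ν s ^ l s

open Finset in
/-- The multinomial theorem, divided by `m!`. -/
theorem sum_piAntidiag_prod_pow_div_factorial {ι : Type*} [Fintype ι] [DecidableEq ι]
    (f : ι → ℝ) (m : ℕ) :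
    ∑ w ∈ piAntidiag univ m, ∏ i, f i ^ w i / ((w i).factorial : ℝ) =
      (∑ i, f i) ^ m / (m.factorial : ℝ) := by
  rw [sum_pow_eq_sum_piAntidiag, sum_div]
  refine sum_congr rfl fun w hw => ?_
  have hsum : ∑ i, w i = m := (mem_piAntidiag.1 hw).1
  have hspec : (∏ i, ((w i).factorial : ℝ)) * (Nat.multinomial univ w : ℝ) =
      (m.factorial : ℝ) := by
    rw [← hsum]
    exact_mod_cast Nat.multinomial_spec univ w
  have h0 : ∏ i, ((w i).factorial : ℝ) ≠ 0 :=
    prod_ne_zero_iff.2 fun i _ => by positivity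
  have hm : (m.factorial : ℝ) ≠ 0 := by positivity
  rw [prod_div_distrib, div_eq_div_iff h0 hm, ← hspec]
  ring

open Finset in
/-- The profile kernel as a finite sum over the transposed matrices of move counts with
prescribed column sums. -/
theorem profileKernel_eq_sum {S : Type*} [Fintype S] [DecidableEq S]
    (K : S → S → ℝ) (l' l : S → ℕ) :
    profileKernel K l' l =
      ∑ v ∈ Fintype.piFinset fun k => piAntidiag (univ : Finset S) (l k),
        if l' = fun j => ∑ k, v k j then
          (∏ j, ((l' j).factorial : ℝ)) * ∏ k, ∏ j, K j k ^ v k j / ((v k j).factorial : ℝ)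
        else 0 := by
  unfold profileKernel
  rw [← (Equiv.piComm fun _ _ : S => ℕ).tsum_eq, tsum_eq_sum
    (s := Fintype.piFinset fun k => piAntidiag (univ : Finset S) (l k))]
  · refine sum_congr rfl fun v hv => ?_
    have hcol : ∀ k, ∑ j, v k j = l k := fun k =>
      (mem_piAntidiag.1 (Fintype.mem_piFinset.1 hv k)).1
    simp only [Equiv.piComm_apply, Function.swap, hcol, implies_true, and_true, funext_iff,
      eq_comm (a := l' _)]
    congr 1
    simp only [prod_div_distrib]
    rw [prod_comm (f := fun k j => K j k ^ v k j),
      prod_comm (f := fun k j => ((v k j).factorial : ℝ))]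
    ring
  · intro v hv
    refine if_neg fun h => hv ?_
    simpa [Fintype.mem_piFinset, mem_piAntidiag, Function.swap] using h.2

open Finset in
/-- The joint weight of a profile and its move counts factors over single moves. -/
theorem multinomialPMF_mul_prod {S : Type*} [Fintype S] (K : S → S → ℝ) (ν : S → ℝ)
    (n : ℕ) (v : S → S → ℕ) :
    multinomialPMF ν n (fun j => ∑ k, v k j) *
        ((∏ j, ((∑ k, v k j).factorial : ℝ)) *
          ∏ k, ∏ j, K j k ^ v k j / ((v k j).factorial : ℝ)) =
      n.factorial * ∏ k, ∏ j, (ν j * K j k) ^ v k j / ((v k j).factorial : ℝ) := by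
  have h0 : ∏ j, ((∑ k, v k j).factorial : ℝ) ≠ 0 :=
    prod_ne_zero_iff.2 fun i _ => by positivity
  have hν : ∏ j, ν j ^ (∑ k, v k j) = ∏ k, ∏ j, ν j ^ v k j := by
    rw [prod_comm]
    exact prod_congr rfl fun j _ => (prod_pow_eq_pow_sum _ _ _).symm
  simp only [multinomialPMF, hν, mul_pow, mul_div_assoc, prod_mul_distrib]
  field_simp

/-- If `ν` is a stationary distribution of the row-stochastic per-device kernel `K`, then
the multinomial distribution `Mul(n, |S|, ν)` is a stationary distribution of the profile
kernel `Q` of equation (9): for every profile `ℓ` of total size `n`,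
`∑_{ℓ'} M(ℓ') Q(ℓ', ℓ) = M(ℓ)`, the sum being over profiles `ℓ'` of total size `n`. -/
theorem multinomial_stationary_of_profileKernel
    {S : Type*} [Fintype S] [DecidableEq S] (K : S → S → ℝ)
    (hK0 : ∀ j k, 0 ≤ K j k) (hK1 : ∀ j, ∑ k, K j k = 1)
    (ν : S → ℝ) (hν0 : ∀ s, 0 ≤ ν s) (hν1 : ∑ s, ν s = 1)
    (hstat : ∀ k, ∑ j, ν j * K j k = ν k)
    (n : ℕ) (l : S → ℕ) (hl : ∑ s, l s = n) :
    ∑' l' : S → ℕ,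
      (if ∑ s, l' s = n then multinomialPMF ν n l' * profileKernel K l' l else 0) =
      multinomialPMF ν n l := by
  have hterm : ∀ l' : S → ℕ,
      (if ∑ s, l' s = n then multinomialPMF ν n l' * profileKernel K l' l else 0) =
      ∑ v ∈ Fintype.piFinset fun k => Finset.piAntidiag (Finset.univ : Finset S) (l k),
        if l' = fun j => ∑ k, v k j then
          n.factorial * ∏ k, ∏ j, (ν j * K j k) ^ v k j / ((v k j).factorial : ℝ)
        else 0 := by
    intro l'
    rw [← boole_mul, profileKernel_eq_sum, Finset.mul_sum, Finset.mul_sum]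
    refine Finset.sum_congr rfl fun v hv => ?_
    by_cases h : l' = fun j => ∑ k, v k j
    · subst h
      have hsum : ∑ j, ∑ k, v k j = n := by
        rw [Finset.sum_comm, ← hl]
        exact Finset.sum_congr rfl fun k _ =>
          (Finset.mem_piAntidiag.1 (Fintype.mem_piFinset.1 hv k)).1
      simp only [hsum, if_true, multinomialPMF_mul_prod, one_mul]
    · simp [h]
  simp only [hterm]
  rw [Summable.tsum_finsetSum fun v _ => (hasSum_ite_eq _ _).summable]
  simp only [tsum_ite_eq]
  rw [← Finset.mul_sum, ← Finset.prod_univ_sum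
    (fun k => Finset.piAntidiag (Finset.univ : Finset S) (l k))
    (fun k w => ∏ j, (ν j * K j k) ^ w j / ((w j).factorial : ℝ))]
  simp only [sum_piAntidiag_prod_pow_div_factorial, hstat]
  rw [multinomialPMF, Finset.prod_div_distrib]
  ring
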